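/- arXiv:2405.16703 — 2 statements merged into one kernel-verified Lean document; each statement's English description precedes it below -/
import Mathlib

section
/- Let V₁, V₂, V₃ be complex vector spaces with sl₂-actions and v_i ∈ V_i primitive of weights m_i (nonnegative integers) with f^{m_i+1} v_i = 0. Let r be a nonnegative integer. Then for every admissible r₁: Ω₁₃ W_{r₁} = −(r−r₁+1)(m₃−r+r₁)·W_{r₁−1} + a_{r₁}·W_{r₁} − γ_{r₁}·W_{r₁+1}, where a_{r₁} = m₁(m₃−2r)/2 + r₁(m₁−m₃+2r−2r₁) + r₁(m₁−r₁+1)(r−r₁+1)(m₃−r+r₁)/(m₁+m₂−2r₁+2) − (r₁+1)(m₁−r₁)(r−r₁)(m₃−r+r₁+1)/(m₁+m₂−2r₁) and γ_{r₁} = (r₁+1)(m₁−r₁)(m₂−r₁)(m₁+m₂−r₁+1)(m₁+m₂−r−r₁)(m₁+m₂+m₃−r−r₁+1) / ((m₁+m₂−2r₁−1)(m₁+m₂−2r₁)²(m₁+m₂−2r₁+1)), with W_{r₁±1} := 0 when r₁±1 is not admissible. -/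
open scoped TensorProduct

/-- An sl₂-action on a complex vector space `V`. -/
def IsSl2Action {V : Type*} [AddCommGroup V] [Module ℂ V]
    (e f h : Module.End ℂ V) : Prop :=
  h ∘ₗ e - e ∘ₗ h = (2 : ℂ) • e ∧ h ∘ₗ f - f ∘ₗ h = (-2 : ℂ) • f ∧ e ∘ₗ f - f ∘ₗ e = h

/-- The falling factorial `(x)_n = x(x−1)⋯(x−n+1)`, with `(x)_0 = 1`. -/
noncomputable def fallFac (x : ℂ) (n : ℕ) : ℂ := ∏ i ∈ Finset.range n, (x - i)

/-- `r₁` is admissible for `(m₁, m₂, m₃, r)` when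
`max(0, r−m₃) ≤ r₁ ≤ min(r, min(m₁,m₂), m₁+m₂−r)`. -/
def Admissible (m₁ m₂ m₃ r : ℕ) (k : ℤ) : Prop :=
  (r : ℤ) - (m₃ : ℤ) ≤ k ∧ 0 ≤ k ∧ k ≤ (r : ℤ) ∧ k ≤ (m₁ : ℤ) ∧ k ≤ (m₂ : ℤ) ∧
    k ≤ (m₁ : ℤ) + (m₂ : ℤ) - (r : ℤ)

/-- The coefficient `C^{r₁}_{i,j}` from the Shapovalov basis formula. -/
noncomputable def Ccoef (m₁ m₂ m₃ r r₁ i j : ℕ) : ℂ :=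
  (1 / (fallFac (m₁ : ℂ) i * fallFac (m₂ : ℂ) (r₁ - i) *
      (Nat.factorial i : ℂ) * (Nat.factorial (r₁ - i) : ℂ))) *
  (1 / (fallFac ((m₁ : ℂ) + (m₂ : ℂ) - 2 * (r₁ : ℂ)) j * fallFac (m₃ : ℂ) (r - r₁ - j) *
      (Nat.factorial j : ℂ) * (Nat.factorial (r - r₁ - j) : ℂ)))

/-- The (unnormalized) Shapovalov basis vector
`W_{r₁} = Σᵢⱼ (−1)^{i+j} C^{r₁}_{i,j} · f^j(fⁱv₁ ⊗ f^{r₁−i}v₂) ⊗ f^{r−r₁−j}v₃`,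
where `f` acts diagonally on the first two tensor factors. -/
noncomputable def Wvec {V₁ V₂ V₃ : Type*} [AddCommGroup V₁] [Module ℂ V₁]
    [AddCommGroup V₂] [Module ℂ V₂] [AddCommGroup V₃] [Module ℂ V₃]
    (f₁ : Module.End ℂ V₁) (f₂ : Module.End ℂ V₂) (f₃ : Module.End ℂ V₃)
    (v₁ : V₁) (v₂ : V₂) (v₃ : V₃) (m₁ m₂ m₃ r r₁ : ℕ) : (V₁ ⊗[ℂ] V₂) ⊗[ℂ] V₃ :=
  ∑ i ∈ Finset.range (r₁ + 1), ∑ j ∈ Finset.range (r - r₁ + 1),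
    ((-1 : ℂ) ^ (i + j) * Ccoef m₁ m₂ m₃ r r₁ i j) •
      ((((LinearMap.rTensor V₂ f₁ + LinearMap.lTensor V₁ f₂ :
            Module.End ℂ (V₁ ⊗[ℂ] V₂)) ^ j)
          (((f₁ ^ i) v₁) ⊗ₜ[ℂ] ((f₂ ^ (r₁ - i)) v₂))) ⊗ₜ[ℂ] ((f₃ ^ (r - r₁ - j)) v₃))

open Classical in
/-- `W_k` extended to integer indices, with `W_k := 0` for non-admissible `k`. -/
noncomputable def WvecZ {V₁ V₂ V₃ : Type*} [AddCommGroup V₁] [Module ℂ V₁]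
    [AddCommGroup V₂] [Module ℂ V₂] [AddCommGroup V₃] [Module ℂ V₃]
    (f₁ : Module.End ℂ V₁) (f₂ : Module.End ℂ V₂) (f₃ : Module.End ℂ V₃)
    (v₁ : V₁) (v₂ : V₂) (v₃ : V₃) (m₁ m₂ m₃ r : ℕ) (k : ℤ) : (V₁ ⊗[ℂ] V₂) ⊗[ℂ] V₃ :=
  if Admissible m₁ m₂ m₃ r k then Wvec f₁ f₂ f₃ v₁ v₂ v₃ m₁ m₂ m₃ r k.toNat else 0

/-- The operator `Ω₁₃ = e ⊗ f + f ⊗ e + ½ h ⊗ h` acting on the first and third tensor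
factors of `V₁ ⊗ V₂ ⊗ V₃` and as the identity on `V₂`. -/
noncomputable def Omega13Triple {V₁ V₂ V₃ : Type*} [AddCommGroup V₁] [Module ℂ V₁]
    [AddCommGroup V₂] [Module ℂ V₂] [AddCommGroup V₃] [Module ℂ V₃]
    (e₁ f₁ h₁ : Module.End ℂ V₁) (e₃ f₃ h₃ : Module.End ℂ V₃) :
    Module.End ℂ ((V₁ ⊗[ℂ] V₂) ⊗[ℂ] V₃) :=
  TensorProduct.map (LinearMap.rTensor V₂ e₁) f₃ +
    TensorProduct.map (LinearMap.rTensor V₂ f₁) e₃ +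
    (2⁻¹ : ℂ) • TensorProduct.map (LinearMap.rTensor V₂ h₁) h₃

open Finset

/-- The normalized string `dₙ = fⁿ v / ((m)ₙ n!)`. -/
noncomputable def ladder {V : Type*} [AddCommGroup V] [Module ℂ V]
    (f : Module.End ℂ V) (v : V) (m n : ℕ) : V :=
  (1 / (fallFac (m : ℂ) n * (Nat.factorial n : ℂ))) • (f ^ n) v

/-- `d` behaves like the normalized weight basis of a highest weight module of weight `m`. -/
structure IsLadder {V : Type*} [AddCommGroup V] [Module ℂ V]
    (e f h : Module.End ℂ V) (m : ℕ) (d : ℕ → V) : Prop where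
  h_apply : ∀ n, h (d n) = ((m : ℂ) - 2 * n) • d n
  f_apply : ∀ n, f (d n) = (((m : ℂ) - n) * (n + 1)) • d (n + 1)
  e_zero : e (d 0) = 0
  e_succ : ∀ n, n < m → e (d (n + 1)) = d n
  eq_zero : ∀ n, m < n → d n = 0

theorem fallFac_succ (x : ℂ) (n : ℕ) : fallFac x (n + 1) = fallFac x n * (x - n) :=
  Finset.prod_range_succ _ _

theorem fallFac_natCast_ne_zero {m n : ℕ} (hn : n ≤ m) : fallFac (m : ℂ) n ≠ 0 := by
  refine Finset.prod_ne_zero_iff.2 fun i hi => sub_ne_zero.2 ?_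
  have := Finset.mem_range.1 hi
  exact_mod_cast (by omega : m ≠ i)

theorem fallFac_natCast_eq_zero {m n : ℕ} (hn : m < n) : fallFac (m : ℂ) n = 0 :=
  Finset.prod_eq_zero (Finset.mem_range.2 hn) (sub_self _)

section Ladder

variable {V : Type*} [AddCommGroup V] [Module ℂ V] {e f h : Module.End ℂ V}

theorem IsSl2Action.h_f (hsl : IsSl2Action e f h) (v : V) :
    h (f v) = f (h v) - (2 : ℂ) • f v := by
  have := LinearMap.congr_fun hsl.2.1 v
  simp only [LinearMap.sub_apply, LinearMap.comp_apply, LinearMap.smul_apply] at this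
  rw [sub_eq_iff_eq_add] at this
  rw [this]; module

theorem IsSl2Action.e_f (hsl : IsSl2Action e f h) (v : V) : e (f v) = f (e v) + h v := by
  have := LinearMap.congr_fun hsl.2.2 v
  simp only [LinearMap.sub_apply, LinearMap.comp_apply] at this
  rw [← this]; abel

theorem IsSl2Action.h_f_pow (hsl : IsSl2Action e f h) {v : V} {m : ℂ} (hh : h v = m • v) (n : ℕ) :
    h ((f ^ n) v) = (m - 2 * n) • (f ^ n) v := by
  induction n with
  | zero => simpa using hh
  | succ n ih =>
    rw [pow_succ', Module.End.mul_apply, hsl.h_f, ih, map_smul]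
    push_cast; module

theorem IsSl2Action.e_f_pow (hsl : IsSl2Action e f h) {v : V} {m : ℂ} (he : e v = 0)
    (hh : h v = m • v) (n : ℕ) :
    e ((f ^ (n + 1)) v) = ((n + 1) * (m - n)) • (f ^ n) v := by
  induction n with
  | zero => simp [hsl.e_f, he, hh]
  | succ n ih =>
    rw [pow_succ', Module.End.mul_apply, hsl.e_f, ih, map_smul, hsl.h_f_pow hh,
      ← Module.End.mul_apply, ← pow_succ']
    push_cast; module

theorem IsSl2Action.f_pow_eq_zero_of_lt (hsl : IsSl2Action e f h) {v : V} {m : ℕ} (he : e v = 0)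
    (hh : h v = (m : ℂ) • v) {N : ℕ} (hN : (f ^ N) v = 0) : (f ^ (m + 1)) v = 0 := by
  induction N with
  | zero => simp_all
  | succ N ih =>
    rcases le_or_gt N m with hNm | hNm
    · obtain ⟨c, rfl⟩ := Nat.exists_eq_add_of_le hNm
      rw [show N + c + 1 = c + (N + 1) by ring, pow_add, Module.End.mul_apply, hN, map_zero]
    · apply ih
      have h1 := hsl.e_f_pow he hh N
      rw [hN, map_zero] at h1
      refine (smul_eq_zero.1 h1.symm).resolve_left (mul_ne_zero N.cast_add_one_ne_zero (sub_ne_zero.2 ?_))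
      exact_mod_cast hNm.ne

theorem IsSl2Action.isLadder (hsl : IsSl2Action e f h) {v : V} {m : ℕ} (he : e v = 0)
    (hh : h v = (m : ℂ) • v) (hnil : (f ^ (m + 1)) v = 0) :
    IsLadder e f h m (ladder f v m) where
  h_apply n := by
    rw [ladder, map_smul, hsl.h_f_pow hh, smul_comm]
  f_apply n := by
    rw [ladder, ladder, map_smul, ← Module.End.mul_apply, ← pow_succ', smul_smul]
    rcases lt_trichotomy n m with hn | rfl | hn
    · congr 1
      have h1 := fallFac_natCast_ne_zero hn.le
      have h2 : (m : ℂ) - n ≠ 0 := sub_ne_zero.2 (by exact_mod_cast hn.ne')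
      have h3 : (n : ℂ) + 1 ≠ 0 := n.cast_add_one_ne_zero
      have h4 : (Nat.factorial n : ℂ) ≠ 0 := by exact_mod_cast Nat.factorial_ne_zero n
      rw [fallFac_succ, Nat.factorial_succ]
      push_cast
      field_simp
    · rw [hnil]; simp
    · rw [fallFac_natCast_eq_zero hn, fallFac_natCast_eq_zero (hn.trans n.lt_succ_self)]; simp
  e_zero := by simp [ladder, he]
  e_succ n hn := by
    rw [ladder, ladder, map_smul, hsl.e_f_pow he hh, smul_smul]
    congr 1
    have h1 := fallFac_natCast_ne_zero hn.le
    have h2 : (m : ℂ) - n ≠ 0 := sub_ne_zero.2 (by exact_mod_cast hn.ne')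
    have h3 : (n : ℂ) + 1 ≠ 0 := n.cast_add_one_ne_zero
    have h4 : (Nat.factorial n : ℂ) ≠ 0 := by exact_mod_cast Nat.factorial_ne_zero n
    rw [fallFac_succ, Nat.factorial_succ]
    push_cast
    field_simp
  eq_zero n hn := by
    rw [ladder, fallFac_natCast_eq_zero hn]; simp

end Ladder

/-- Prepends a zero to a sequence. -/
def shiftSeq {V : Type*} [Zero V] (d : ℕ → V) : ℕ → V
  | 0 => 0
  | n + 1 => d n

section SumShift

variable {V : Type*} [AddCommGroup V]

theorem sum_antidiagonal_shift_left (n : ℕ) (g : ℕ → ℕ → V) (h0 : g 0 (n + 1) = 0) :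
    ∑ p ∈ antidiagonal n, g (p.1 + 1) p.2 = ∑ p ∈ antidiagonal (n + 1), g p.1 p.2 := by
  rw [Finset.Nat.sum_antidiagonal_succ, h0, zero_add]

theorem sum_antidiagonal_shift_right (n : ℕ) (g : ℕ → ℕ → V) (h0 : g (n + 1) 0 = 0) :
    ∑ p ∈ antidiagonal n, g p.1 (p.2 + 1) = ∑ p ∈ antidiagonal (n + 1), g p.1 p.2 := by
  rw [Finset.Nat.sum_antidiagonal_succ', h0, zero_add]

end SumShift

section TwoFactors

variable {V₁ V₂ : Type*} [AddCommGroup V₁] [Module ℂ V₁] [AddCommGroup V₂] [Module ℂ V₂]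

/-- The diagonal action of a pair of endomorphisms on a tensor product. -/
noncomputable abbrev diagAct (x₁ : Module.End ℂ V₁) (x₂ : Module.End ℂ V₂) :
    Module.End ℂ (V₁ ⊗[ℂ] V₂) :=
  LinearMap.rTensor V₂ x₁ + LinearMap.lTensor V₁ x₂

theorem diagAct_tmul (x₁ : Module.End ℂ V₁) (x₂ : Module.End ℂ V₂) (a : V₁) (b : V₂) :
    diagAct x₁ x₂ (a ⊗ₜ b) = x₁ a ⊗ₜ b + a ⊗ₜ x₂ b := by
  simp [diagAct]

/-- The vector `∑_{a+b=n} (-1)^a g(a,b) d_a ⊗ d'_b`. -/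
noncomputable def altSum (d : ℕ → V₁) (d' : ℕ → V₂) (n : ℕ) (g : ℂ → ℂ → ℂ) : V₁ ⊗[ℂ] V₂ :=
  ∑ p ∈ antidiagonal n, ((-1 : ℂ) ^ p.1 * g p.1 p.2) • (d p.1 ⊗ₜ[ℂ] d' p.2)

variable {d : ℕ → V₁} {d' : ℕ → V₂} {m₁ m₂ : ℕ}
  {e₁ f₁ h₁ : Module.End ℂ V₁} {e₂ f₂ h₂ : Module.End ℂ V₂}

theorem altSum_congr {n : ℕ} {g g' : ℂ → ℂ → ℂ}
    (hg : ∀ a b : ℂ, a + b = n → g a b = g' a b) : altSum d d' n g = altSum d d' n g' := by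
  refine Finset.sum_congr rfl fun p hp => ?_
  rw [hg]
  exact_mod_cast Finset.HasAntidiagonal.mem_antidiagonal.1 hp

theorem smul_altSum (c : ℂ) (n : ℕ) (g : ℂ → ℂ → ℂ) :
    c • altSum d d' n g = altSum d d' n fun a b => c * g a b := by
  simp only [altSum, Finset.smul_sum, smul_smul]
  refine Finset.sum_congr rfl fun p _ => ?_
  congr 1; ring

theorem altSum_add (n : ℕ) (g g' : ℂ → ℂ → ℂ) :
    altSum d d' n g + altSum d d' n g' = altSum d d' n fun a b => g a b + g' a b := by
  simp only [altSum, ← Finset.sum_add_distrib, ← add_smul, mul_add]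

theorem altSum_eq_zero (hd : IsLadder e₁ f₁ h₁ m₁ d) (hd' : IsLadder e₂ f₂ h₂ m₂ d') {n : ℕ}
    (hn : m₁ + m₂ < n) (g : ℂ → ℂ → ℂ) : altSum d d' n g = 0 := by
  refine Finset.sum_eq_zero fun p hp => ?_
  have := Finset.HasAntidiagonal.mem_antidiagonal.1 hp
  rcases lt_or_ge m₁ p.1 with h | h
  · simp [hd.eq_zero _ h]
  · simp [hd'.eq_zero p.2 (by omega)]

theorem rTensor_f_altSum (hd : IsLadder e₁ f₁ h₁ m₁ d) (n : ℕ) (g : ℂ → ℂ → ℂ) :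
    LinearMap.rTensor V₂ f₁ (altSum d d' n g) =
      altSum d d' (n + 1) fun a b => -((m₁ - a + 1) * a * g (a - 1) b) := by
  rw [altSum, altSum, ← sum_antidiagonal_shift_left n (fun a b =>
    ((-1 : ℂ) ^ a * -(((m₁ : ℂ) - a + 1) * a * g (a - 1) b)) • (d a ⊗ₜ[ℂ] d' b)) (by simp), map_sum]
  refine Finset.sum_congr rfl fun p _ => ?_
  rw [map_smul, LinearMap.rTensor_tmul, hd.f_apply, ← TensorProduct.smul_tmul', smul_smul]
  congr 1
  push_cast
  rw [add_sub_cancel_right]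
  ring

theorem lTensor_f_altSum (hd' : IsLadder e₂ f₂ h₂ m₂ d') (n : ℕ) (g : ℂ → ℂ → ℂ) :
    LinearMap.lTensor V₁ f₂ (altSum d d' n g) =
      altSum d d' (n + 1) fun a b => (m₂ - b + 1) * b * g a (b - 1) := by
  rw [altSum, altSum, ← sum_antidiagonal_shift_right n (fun a b =>
    ((-1 : ℂ) ^ a * (((m₂ : ℂ) - b + 1) * b * g a (b - 1))) • (d a ⊗ₜ[ℂ] d' b)) (by simp), map_sum]
  refine Finset.sum_congr rfl fun p _ => ?_
  rw [map_smul, LinearMap.lTensor_tmul, hd'.f_apply, TensorProduct.tmul_smul, smul_smul]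
  congr 1
  push_cast
  rw [add_sub_cancel_right]
  ring

theorem diagAct_f_altSum (hd : IsLadder e₁ f₁ h₁ m₁ d) (hd' : IsLadder e₂ f₂ h₂ m₂ d') (n : ℕ)
    (g : ℂ → ℂ → ℂ) :
    diagAct f₁ f₂ (altSum d d' n g) =
      altSum d d' (n + 1) fun a b =>
        -((m₁ - a + 1) * a * g (a - 1) b) + (m₂ - b + 1) * b * g a (b - 1) := by
  rw [LinearMap.add_apply, rTensor_f_altSum hd, lTensor_f_altSum hd', altSum_add]

theorem diagAct_f_pow_altSum_eq_zero (hd : IsLadder e₁ f₁ h₁ m₁ d)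
    (hd' : IsLadder e₂ f₂ h₂ m₂ d') (n : ℕ) (g : ℂ → ℂ → ℂ) :
    (diagAct f₁ f₂ ^ (m₁ + m₂ + 1)) (altSum d d' n g) = 0 := by
  have key : ∀ N : ℕ, ∃ g', (diagAct f₁ f₂ ^ N) (altSum d d' n g) = altSum d d' (n + N) g' := by
    intro N
    induction N with
    | zero => exact ⟨g, rfl⟩
    | succ N ih =>
      obtain ⟨g', hg'⟩ := ih
      rw [pow_succ', Module.End.mul_apply, hg', diagAct_f_altSum hd hd']
      exact ⟨_, rfl⟩
  obtain ⟨g', hg'⟩ := key (m₁ + m₂ + 1)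
  rw [hg', altSum_eq_zero hd hd' (by omega)]

theorem rTensor_h_altSum (hd : IsLadder e₁ f₁ h₁ m₁ d) (n : ℕ) (g : ℂ → ℂ → ℂ) :
    LinearMap.rTensor V₂ h₁ (altSum d d' n g) =
      altSum d d' n fun a b => (m₁ - 2 * a) * g a b := by
  rw [altSum, altSum, map_sum]
  refine Finset.sum_congr rfl fun p _ => ?_
  rw [map_smul, LinearMap.rTensor_tmul, hd.h_apply, ← TensorProduct.smul_tmul', smul_smul]
  congr 1; ring

theorem lTensor_h_altSum (hd' : IsLadder e₂ f₂ h₂ m₂ d') (n : ℕ) (g : ℂ → ℂ → ℂ) :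
    LinearMap.lTensor V₁ h₂ (altSum d d' n g) =
      altSum d d' n fun a b => (m₂ - 2 * b) * g a b := by
  rw [altSum, altSum, map_sum]
  refine Finset.sum_congr rfl fun p _ => ?_
  rw [map_smul, LinearMap.lTensor_tmul, hd'.h_apply, TensorProduct.tmul_smul, smul_smul]
  congr 1; ring

/-- The singular vector `∑_{a+b=k} (-1)^a d_a ⊗ d'_b`. -/
noncomputable def singVec (d : ℕ → V₁) (d' : ℕ → V₂) (k : ℕ) : V₁ ⊗[ℂ] V₂ :=
  altSum d d' k fun _ _ => 1

theorem rTensor_e_singVec (hd : IsLadder e₁ f₁ h₁ m₁ d) {k : ℕ} (hk : k ≤ m₁) :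
    LinearMap.rTensor V₂ e₁ (singVec d d' k) = -shiftSeq (singVec d d') k := by
  cases k with
  | zero => simp [singVec, altSum, shiftSeq, hd.e_zero]
  | succ k =>
    rw [shiftSeq, singVec, singVec, altSum, altSum, map_sum, Finset.Nat.sum_antidiagonal_succ,
      ← Finset.sum_neg_distrib]
    simp only [map_smul, LinearMap.rTensor_tmul, hd.e_zero, TensorProduct.zero_tmul, smul_zero,
      zero_add]
    refine Finset.sum_congr rfl fun p hp => ?_
    have := Finset.HasAntidiagonal.mem_antidiagonal.1 hp
    rw [hd.e_succ _ (by omega), ← neg_smul]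
    congr 1; ring

theorem lTensor_e_singVec (hd' : IsLadder e₂ f₂ h₂ m₂ d') {k : ℕ} (hk : k ≤ m₂) :
    LinearMap.lTensor V₁ e₂ (singVec d d' k) = shiftSeq (singVec d d') k := by
  cases k with
  | zero => simp [singVec, altSum, shiftSeq, hd'.e_zero]
  | succ k =>
    rw [shiftSeq, singVec, singVec, altSum, altSum, map_sum, Finset.Nat.sum_antidiagonal_succ']
    simp only [map_smul, LinearMap.lTensor_tmul, hd'.e_zero, TensorProduct.tmul_zero, smul_zero,
      zero_add]
    refine Finset.sum_congr rfl fun p hp => ?_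
    have := Finset.HasAntidiagonal.mem_antidiagonal.1 hp
    rw [hd'.e_succ _ (by omega)]

theorem diagAct_e_singVec (hd : IsLadder e₁ f₁ h₁ m₁ d) (hd' : IsLadder e₂ f₂ h₂ m₂ d') {k : ℕ}
    (hk : k ≤ m₁) (hk' : k ≤ m₂) : diagAct e₁ e₂ (singVec d d' k) = 0 := by
  rw [LinearMap.add_apply, rTensor_e_singVec hd hk, lTensor_e_singVec hd' hk', neg_add_cancel]

theorem diagAct_h_singVec (hd : IsLadder e₁ f₁ h₁ m₁ d) (hd' : IsLadder e₂ f₂ h₂ m₂ d') {k M : ℕ}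
    (hM : m₁ + m₂ = M + 2 * k) :
    diagAct h₁ h₂ (singVec d d' k) = (M : ℂ) • singVec d d' k := by
  rw [LinearMap.add_apply, singVec, rTensor_h_altSum hd, lTensor_h_altSum hd', altSum_add,
    smul_altSum]
  refine altSum_congr fun a b hab => ?_
  have hM' : (m₁ : ℂ) + m₂ = M + 2 * k := by exact_mod_cast hM
  linear_combination hM' - 2 * hab

theorem diagAct_f_shiftSeq_singVec (hd : IsLadder e₁ f₁ h₁ m₁ d)
    (hd' : IsLadder e₂ f₂ h₂ m₂ d') (k : ℕ) :
    diagAct f₁ f₂ (shiftSeq (singVec d d') k) =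
      altSum d d' k fun a b => -((m₁ - a + 1) * a) + (m₂ - b + 1) * b := by
  cases k with
  | zero => simp [shiftSeq, altSum]
  | succ k =>
    rw [shiftSeq, singVec, diagAct_f_altSum hd hd']
    refine altSum_congr fun a b _ => by ring

theorem rTensor_h_singVec (hd : IsLadder e₁ f₁ h₁ m₁ d) (hd' : IsLadder e₂ f₂ h₂ m₂ d')
    {k M : ℕ} (hM : m₁ + m₂ = M + 2 * k) :
    LinearMap.rTensor V₂ h₁ (singVec d d' k) =
      ((m₁ : ℂ) - 2 * k * (m₂ - k + 1) / (M + 2)) • singVec d d' k +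
        (2 / ((M : ℂ) + 2)) • diagAct f₁ f₂ (shiftSeq (singVec d d') k) := by
  rw [diagAct_f_shiftSeq_singVec hd hd', singVec, rTensor_h_altSum hd, smul_altSum, smul_altSum,
    altSum_add]
  refine altSum_congr fun a b hab => ?_
  have hM' : (m₁ : ℂ) = M + 2 * k - m₂ := by rw [eq_sub_iff_add_eq]; exact_mod_cast hM
  have h2 : (M : ℂ) + 2 ≠ 0 := by exact_mod_cast (by omega : M + 2 ≠ 0)
  obtain rfl : b = k - a := by rw [← hab]; ring
  rw [hM']
  field_simp
  ring

theorem rTensor_f_singVec (hd : IsLadder e₁ f₁ h₁ m₁ d) (hd' : IsLadder e₂ f₂ h₂ m₂ d')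
    {k M : ℕ} (hk : k ≤ m₁) (hk' : k ≤ m₂) (hM : m₁ + m₂ = M + 2 * k) :
    LinearMap.rTensor V₂ f₁ (singVec d d' k) =
      (-(((k : ℂ) + 1) * (m₁ - k) * (m₂ - k) * (m₁ + m₂ - k + 1)) / ((M + 1) * M)) •
          singVec d d' (k + 1) +
        (((m₁ : ℂ) - 2 * k * (m₂ - k + 1) / (M + 2)) / M) • diagAct f₁ f₂ (singVec d d' k) +
        (1 / (((M : ℂ) + 1) * (M + 2))) •
          diagAct f₁ f₂ (diagAct f₁ f₂ (shiftSeq (singVec d d') k)) := by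
  rw [diagAct_f_shiftSeq_singVec hd hd', diagAct_f_altSum hd hd', singVec, singVec,
    diagAct_f_altSum hd hd', rTensor_f_altSum hd, smul_altSum, smul_altSum, smul_altSum,
    altSum_add, altSum_add]
  refine altSum_congr fun a b hab => ?_
  have hM' : (m₁ : ℂ) = M + 2 * k - m₂ := by rw [eq_sub_iff_add_eq]; exact_mod_cast hM
  have h1 : (M : ℂ) + 1 ≠ 0 := M.cast_add_one_ne_zero
  have h2 : (M : ℂ) + 2 ≠ 0 := by exact_mod_cast (by omega : M + 2 ≠ 0)
  obtain rfl : b = k + 1 - a := by push_cast at hab; rw [← hab]; ring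
  rcases Nat.eq_zero_or_pos M with rfl | hpos
  · obtain rfl : m₁ = k := by omega
    obtain rfl : m₂ = m₁ := by omega
    simp
    ring
  · have h0 : (M : ℂ) ≠ 0 := by exact_mod_cast hpos.ne'
    rw [hM']
    field_simp
    ring

theorem IsSl2Action.diagAct (hsl₁ : IsSl2Action e₁ f₁ h₁) (hsl₂ : IsSl2Action e₂ f₂ h₂) :
    IsSl2Action (diagAct e₁ e₂) (diagAct f₁ f₂) (diagAct h₁ h₂) := by
  refine ⟨?_, ?_, ?_⟩
  · have A : ∀ v, h₁ (e₁ v) = e₁ (h₁ v) + (2 : ℂ) • e₁ v := fun v => by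
      have := LinearMap.congr_fun hsl₁.1 v
      exact (sub_eq_iff_eq_add'.1 this)
    have B : ∀ v, h₂ (e₂ v) = e₂ (h₂ v) + (2 : ℂ) • e₂ v := fun v => by
      have := LinearMap.congr_fun hsl₂.1 v
      exact (sub_eq_iff_eq_add'.1 this)
    refine TensorProduct.ext' fun a b => ?_
    simp only [LinearMap.sub_apply, LinearMap.comp_apply, LinearMap.smul_apply, diagAct_tmul,
      map_add, A, B, TensorProduct.add_tmul, TensorProduct.tmul_add, ← TensorProduct.smul_tmul',
      TensorProduct.tmul_smul]
    module
  · refine TensorProduct.ext' fun a b => ?_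
    simp only [LinearMap.sub_apply, LinearMap.comp_apply, LinearMap.smul_apply, diagAct_tmul,
      map_add, hsl₁.h_f, hsl₂.h_f, TensorProduct.sub_tmul, TensorProduct.tmul_sub,
      ← TensorProduct.smul_tmul', TensorProduct.tmul_smul]
    module
  · refine TensorProduct.ext' fun a b => ?_
    simp only [LinearMap.sub_apply, LinearMap.comp_apply, diagAct_tmul,
      map_add, hsl₁.e_f, hsl₂.e_f, TensorProduct.add_tmul, TensorProduct.tmul_add]
    abel

theorem rTensor_f_diagAct_f (x : V₁ ⊗[ℂ] V₂) :
    LinearMap.rTensor V₂ f₁ (diagAct f₁ f₂ x) = diagAct f₁ f₂ (LinearMap.rTensor V₂ f₁ x) := by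
  induction x with
  | zero => simp
  | add x y hx hy => simp only [map_add, hx, hy]
  | tmul a b => simp

theorem rTensor_h_diagAct_f (hsl₁ : IsSl2Action e₁ f₁ h₁) (x : V₁ ⊗[ℂ] V₂) :
    LinearMap.rTensor V₂ h₁ (diagAct f₁ f₂ x) =
      diagAct f₁ f₂ (LinearMap.rTensor V₂ h₁ x) - (2 : ℂ) • LinearMap.rTensor V₂ f₁ x := by
  induction x with
  | zero => simp
  | add x y hx hy => simp only [map_add, hx, hy]; module
  | tmul a b =>
    simp only [diagAct_tmul, map_add, LinearMap.rTensor_tmul, hsl₁.h_f, TensorProduct.sub_tmul,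
      ← TensorProduct.smul_tmul']
    module

theorem rTensor_e_diagAct_f (hsl₁ : IsSl2Action e₁ f₁ h₁) (x : V₁ ⊗[ℂ] V₂) :
    LinearMap.rTensor V₂ e₁ (diagAct f₁ f₂ x) =
      diagAct f₁ f₂ (LinearMap.rTensor V₂ e₁ x) + LinearMap.rTensor V₂ h₁ x := by
  induction x with
  | zero => simp
  | add x y hx hy => simp only [map_add, hx, hy]; abel
  | tmul a b =>
    simp only [diagAct_tmul, map_add, LinearMap.rTensor_tmul, hsl₁.e_f, TensorProduct.add_tmul]
    abel

theorem isLadder_singVec (hsl₁ : IsSl2Action e₁ f₁ h₁) (hsl₂ : IsSl2Action e₂ f₂ h₂)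
    (hd : IsLadder e₁ f₁ h₁ m₁ d) (hd' : IsLadder e₂ f₂ h₂ m₂ d') {k M : ℕ}
    (hk : k ≤ m₁) (hk' : k ≤ m₂) (hM : m₁ + m₂ = M + 2 * k) :
    IsLadder (diagAct e₁ e₂) (diagAct f₁ f₂) (diagAct h₁ h₂) M
      (ladder (diagAct f₁ f₂) (singVec d d' k) M) := by
  have hsl := hsl₁.diagAct hsl₂
  have he := diagAct_e_singVec hd hd' hk hk'
  have hh := diagAct_h_singVec hd hd' hM
  exact hsl.isLadder he hh
    (hsl.f_pow_eq_zero_of_lt he hh (diagAct_f_pow_altSum_eq_zero hd hd' k _))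

end TwoFactors

section Strings

variable {U : Type*} [AddCommGroup U] [Module ℂ U] {e f h F : Module.End ℂ U}

theorem string_action (hfF : ∀ u, f (F u) = F (f u))
    (hhF : ∀ u, h (F u) = F (h u) - (2 : ℂ) • f u)
    (heF : ∀ u, e (F u) = F (e u) + h u) {x y z : ℕ → U} {M : ℕ} {α β : ℂ}
    (hx₀ : x 0 = 0) (hx : ∀ n : ℕ, F (x n) = (((M : ℂ) - n + 1) * n) • x (n + 1))
    (hy : ∀ n : ℕ, F (y n) = (((M : ℂ) - n) * (n - 1)) • y (n + 1))
    (hz : ∀ n : ℕ, F (z n) = (((M : ℂ) - n + 2) * (n + 1)) • z (n + 1))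
    (hy₀ : y 0 = 0) (hy₁ : y 1 = 0)
    (hf₀ : f (x 1) = (α * (M * (M - 1))) • y 2 + (β * M) • x 2 + (2 : ℂ) • z 2)
    (hh₀ : h (x 1) = (β * M) • x 1 + (2 : ℂ) • z 1)
    (he₀ : e (x 1) = -z 0) (n : ℕ) (hn : n ≤ M) :
    f (x (n + 1)) = (α * ((M - n) * (M - n - 1))) • y (n + 2) +
        (β * ((M - n) * (n + 1))) • x (n + 2) + (((n : ℂ) + 1) * (n + 2)) • z (n + 2) ∧
      h (x (n + 1)) = (α * (-2 * (M - n))) • y (n + 1) + (β * (M - 2 * n)) • x (n + 1) +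
        (2 * ((n : ℂ) + 1)) • z (n + 1) ∧
      e (x (n + 1)) = (-α) • y n + β • x n - z n := by
  induction n with
  | zero => simp [hf₀, hh₀, he₀, hy₀, hy₁, hx₀]
  | succ n ih =>
    obtain ⟨ihf, ihh, ihe⟩ := ih (by omega)
    have hc : ((M : ℂ) - n) * (n + 1) ≠ 0 :=
      mul_ne_zero (sub_ne_zero.2 (by exact_mod_cast (by omega : M ≠ n))) n.cast_add_one_ne_zero
    have hstep : F (x (n + 1)) = (((M : ℂ) - n) * (n + 1)) • x (n + 2) := by
      rw [hx]; congr 1; push_cast; ring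
    refine ⟨?_, ?_, ?_⟩ <;> refine smul_right_injective U hc ?_ <;> dsimp only <;>
      rw [← map_smul, ← hstep]
    · rw [hfF, ihf]
      simp only [map_add, map_smul, hx, hy, hz]
      push_cast; module
    · rw [hhF, ihf, ihh]
      simp only [map_add, map_smul, hx, hy, hz]
      push_cast; module
    · rw [heF, ihh, ihe]
      simp only [map_add, map_sub, map_smul, hx, hy, hz]
      module

end Strings

section PairSum

variable {U V : Type*} [AddCommGroup U] [Module ℂ U] [AddCommGroup V] [Module ℂ V]

theorem altSum_shift {x : ℕ → U} {d : ℕ → V} (s : ℕ) (g : ℂ → ℂ → ℂ) :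
    altSum (shiftSeq x) d (s + 1) g = - altSum x d s fun a b => g (a + 1) b := by
  rw [altSum, altSum, Finset.Nat.sum_antidiagonal_succ, ← Finset.sum_neg_distrib]
  simp only [shiftSeq, TensorProduct.zero_tmul, smul_zero, zero_add]
  refine Finset.sum_congr rfl fun p _ => ?_
  rw [← neg_smul]
  congr 1
  push_cast
  ring

theorem altSum_shift_right {x : ℕ → U} {d : ℕ → V} (s : ℕ) (g : ℂ → ℂ → ℂ) :
    altSum x (shiftSeq d) (s + 1) g = altSum x d s fun a b => g a (b + 1) := by
  rw [altSum, altSum, Finset.Nat.sum_antidiagonal_succ']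
  simp only [shiftSeq, TensorProduct.tmul_zero, smul_zero, zero_add]
  refine Finset.sum_congr rfl fun p _ => ?_
  congr 1
  push_cast
  ring

/-- Reindexing of the three contributions to a fixed string in the action of the Casimir tensor. -/
theorem sum_three_terms {G : ℕ → U} {D : ℕ → V} (s : ℕ) (c₁ c₂ c₃ : ℂ → ℂ → ℂ) (hD : D 0 = 0)
    (hc₁ : ∀ a, c₁ a (-1) = 0) (hc₂ : ∀ b, c₂ (-1) b • G 0 = 0)
    (hc₃ : ∀ b, c₃ (-2) b • G 0 = 0) (hc₃' : ∀ b, c₃ (-1) b • G 1 = 0) :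
    ∑ p ∈ antidiagonal s, (-1 : ℂ) ^ p.1 •
      (c₁ p.1 p.2 • (G p.1 ⊗ₜ[ℂ] D (p.2 + 2)) + c₂ p.1 p.2 • (G (p.1 + 1) ⊗ₜ[ℂ] D (p.2 + 1)) +
        c₃ p.1 p.2 • (G (p.1 + 2) ⊗ₜ[ℂ] D p.2)) =
      altSum G D (s + 2) fun a b => c₁ a (b - 2) - c₂ (a - 1) (b - 1) + c₃ (a - 2) b := by
  have E₁ : altSum G D (s + 2) (fun a b => c₁ a (b - 2)) =
      ∑ p ∈ antidiagonal s, (-1 : ℂ) ^ p.1 • c₁ p.1 p.2 • (G p.1 ⊗ₜ[ℂ] D (p.2 + 2)) := by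
    rw [altSum, Finset.Nat.sum_antidiagonal_succ', Finset.Nat.sum_antidiagonal_succ']
    have h : (1 : ℂ) - 2 = -1 := by norm_num
    simp only [hD, TensorProduct.tmul_zero, smul_zero, zero_add, Nat.cast_add, Nat.cast_one, h,
      hc₁, mul_zero, zero_smul]
    refine Finset.sum_congr rfl fun p _ => ?_
    rw [smul_smul, show (p.2 : ℂ) + 1 + 1 - 2 = p.2 by ring]
  have E₂ : altSum G D (s + 2) (fun a b => c₂ (a - 1) (b - 1)) =
      -∑ p ∈ antidiagonal s, (-1 : ℂ) ^ p.1 • c₂ p.1 p.2 • (G (p.1 + 1) ⊗ₜ[ℂ] D (p.2 + 1)) := by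
    rw [altSum, Finset.Nat.sum_antidiagonal_succ', Finset.Nat.sum_antidiagonal_succ,
      ← Finset.sum_neg_distrib]
    simp only [hD, TensorProduct.tmul_zero, smul_zero, zero_add, Nat.cast_zero, zero_sub,
      mul_smul, TensorProduct.smul_tmul', hc₂, TensorProduct.zero_tmul]
    refine Finset.sum_congr rfl fun p _ => ?_
    rw [Nat.cast_succ, Nat.cast_succ, add_sub_cancel_right, add_sub_cancel_right, pow_succ,
      mul_neg_one, neg_smul, TensorProduct.neg_tmul]
  have E₃ : altSum G D (s + 2) (fun a b => c₃ (a - 2) b) =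
      ∑ p ∈ antidiagonal s, (-1 : ℂ) ^ p.1 • c₃ p.1 p.2 • (G (p.1 + 2) ⊗ₜ[ℂ] D p.2) := by
    rw [altSum, Finset.Nat.sum_antidiagonal_succ, Finset.Nat.sum_antidiagonal_succ]
    have h : (1 : ℂ) - 2 = -1 := by norm_num
    simp only [zero_add, Nat.cast_zero, zero_sub, Nat.cast_add, Nat.cast_one, h,
      mul_smul, TensorProduct.smul_tmul', hc₃, hc₃', TensorProduct.zero_tmul, smul_zero]
    refine Finset.sum_congr rfl fun p _ => ?_
    rw [show (p.1 : ℂ) + 1 + 1 - 2 = p.1 by ring, pow_succ, pow_succ, mul_assoc, neg_one_mul,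
      neg_neg, mul_one]
  have E : (altSum G D (s + 2) fun a b => c₁ a (b - 2) - c₂ (a - 1) (b - 1) + c₃ (a - 2) b) =
      altSum G D (s + 2) (fun a b => c₁ a (b - 2)) -
        altSum G D (s + 2) (fun a b => c₂ (a - 1) (b - 1)) +
        altSum G D (s + 2) (fun a b => c₃ (a - 2) b) := by
    rw [sub_eq_add_neg, ← neg_one_smul ℂ, smul_altSum, altSum_add, altSum_add]
    exact altSum_congr fun a b _ => by ring
  rw [E, E₁, E₂, E₃]
  simp only [smul_add, Finset.sum_add_distrib, sub_neg_eq_add]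

theorem casimir_altSum {e f h : Module.End ℂ U} {e' f' h' : Module.End ℂ V} {x y z : ℕ → U}
    {d : ℕ → V} {M m s : ℕ} {α β : ℂ} (hd : IsLadder e' f' h' m d) (hsm : s ≤ m)
    (hx₀ : x 0 = 0) (hy₀ : y 0 = 0) (hy₁ : y 1 = 0)
    (hstr : ∀ n ≤ s,
      f (x (n + 1)) = (α * ((M - n) * (M - n - 1))) • y (n + 2) +
        (β * ((M - n) * (n + 1))) • x (n + 2) + (((n : ℂ) + 1) * (n + 2)) • z (n + 2) ∧
      h (x (n + 1)) = (α * (-2 * (M - n))) • y (n + 1) + (β * (M - 2 * n)) • x (n + 1) +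
        (2 * ((n : ℂ) + 1)) • z (n + 1) ∧
      e (x (n + 1)) = (-α) • y n + β • x n - z n) :
    (TensorProduct.map e f' + TensorProduct.map f e' + (2⁻¹ : ℂ) • TensorProduct.map h h')
        (altSum (fun n => x (n + 1)) d s fun _ _ => 1) =
      (α * ((M - s) * (M - s + m + 1))) • altSum y (shiftSeq d) (s + 2) (fun _ _ => 1) +
        (β * (s * (M + m - s + 1) - M * m / 2)) • altSum x (shiftSeq d) (s + 2) (fun _ _ => 1) +
        (((s : ℂ) + 1) * (s - m)) • altSum z (shiftSeq d) (s + 2) (fun _ _ => 1) := by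
  have he' : ∀ n ≤ s, e' (d n) = shiftSeq d n := by
    rintro (_ | n) hn
    · exact hd.e_zero
    · exact hd.e_succ n (by omega)
  have hy := sum_three_terms (G := y) (D := shiftSeq d) s
    (fun _ b => -α * ((m - b) * (b + 1))) (fun a b => α * (-(M - a) * (m - 2 * b)))
    (fun a _ => α * ((M - a) * (M - a - 1))) rfl (by simp) (by simp [hy₀]) (by simp [hy₀])
    (by simp [hy₁])
  have hx := sum_three_terms (G := x) (D := shiftSeq d) s
    (fun _ b => β * ((m - b) * (b + 1))) (fun a b => β * ((M - 2 * a) * (m - 2 * b) / 2))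
    (fun a _ => β * ((M - a) * (a + 1))) rfl (by simp) (by simp [hx₀]) (by simp [hx₀]) (by simp)
  have hz := sum_three_terms (G := z) (D := shiftSeq d) s
    (fun _ b => -((m - b) * (b + 1))) (fun a b => (a + 1) * (m - 2 * b))
    (fun a _ => (a + 1) * (a + 2)) rfl (by simp) (by simp) (by simp) (by simp)
  rw [smul_altSum, smul_altSum, smul_altSum]
  have key : ∀ a b : ℂ, a + b = (s + 2 : ℕ) → b = s + 2 - a := fun a b hab => by
    push_cast at hab; rw [← hab]; ring
  rw [altSum_congr (g' := fun _ _ => α * ((M - s) * (M - s + m + 1)) * 1) fun a b hab => by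
    rw [key a b hab]; ring] at hy
  rw [altSum_congr (g' := fun _ _ => β * (s * (M + m - s + 1) - M * m / 2) * 1) fun a b hab => by
    rw [key a b hab]; ring] at hx
  rw [altSum_congr (g' := fun _ _ => ((s : ℂ) + 1) * (s - m) * 1) fun a b hab => by
    rw [key a b hab]; ring] at hz
  rw [← hy, ← hx, ← hz, ← Finset.sum_add_distrib, ← Finset.sum_add_distrib, altSum, map_sum]
  refine Finset.sum_congr rfl fun p hp => ?_
  have hps := Finset.HasAntidiagonal.mem_antidiagonal.1 hp
  obtain ⟨h₁, h₂, h₃⟩ := hstr p.1 (by omega)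
  rw [map_smul, mul_one, ← smul_add, ← smul_add]
  congr 1
  simp only [LinearMap.add_apply, LinearMap.smul_apply, TensorProduct.map_tmul, h₁, h₂, h₃,
    he' p.2 (by omega), hd.h_apply, hd.f_apply, TensorProduct.add_tmul, TensorProduct.sub_tmul,
    ← TensorProduct.smul_tmul', TensorProduct.tmul_smul, shiftSeq]
  module

theorem ladder_zero (f : Module.End ℂ V) (v : V) (m : ℕ) : ladder f v m 0 = v := by
  simp [ladder, fallFac]

theorem ladder_of_zero (f : Module.End ℂ V) (m : ℕ) : ladder f 0 m = 0 := by
  ext n; simp [ladder]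

theorem altSum_zero_left (d : ℕ → V) (n : ℕ) (g : ℂ → ℂ → ℂ) :
    altSum (0 : ℕ → U) d n g = 0 := by
  simp [altSum]

end PairSum

section ThreeFactors

variable {V₁ V₂ V₃ : Type*} [AddCommGroup V₁] [Module ℂ V₁]
    [AddCommGroup V₂] [Module ℂ V₂] [AddCommGroup V₃] [Module ℂ V₃]

theorem Wvec_eq_altSum (f₁ : Module.End ℂ V₁) (f₂ : Module.End ℂ V₂) (f₃ : Module.End ℂ V₃)
    (v₁ : V₁) (v₂ : V₂) (v₃ : V₃) {m₁ m₂ M k : ℕ} (m₃ r : ℕ) (hM : m₁ + m₂ = M + 2 * k) :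
    Wvec f₁ f₂ f₃ v₁ v₂ v₃ m₁ m₂ m₃ r k =
      altSum (ladder (diagAct f₁ f₂) (singVec (ladder f₁ v₁ m₁) (ladder f₂ v₂ m₂) k) M)
        (ladder f₃ v₃ m₃) (r - k) fun _ _ => 1 := by
  have hM' : (m₁ : ℂ) + m₂ - 2 * k = M := by
    rw [sub_eq_iff_eq_add]; exact_mod_cast hM
  rw [Wvec, Finset.sum_comm, altSum, Finset.Nat.sum_antidiagonal_eq_sum_range_succ_mk]
  refine Finset.sum_congr rfl fun j _ => ?_
  rw [singVec, altSum, Finset.Nat.sum_antidiagonal_eq_sum_range_succ_mk, ladder, map_sum,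
    Finset.smul_sum, TensorProduct.sum_tmul, Finset.smul_sum]
  refine Finset.sum_congr rfl fun i _ => ?_
  simp only [ladder, Ccoef, hM', map_smul, ← TensorProduct.smul_tmul', TensorProduct.tmul_smul,
    smul_smul]
  congr 1
  simp only [one_div, mul_inv]
  ring

end ThreeFactors

/-- The tridiagonal action of `Ω₁₃` on the (unnormalized) Shapovalov basis:
`Ω₁₃ W_{r₁} = −(r−r₁+1)(m₃−r+r₁)·W_{r₁−1} + a_{r₁}·W_{r₁} − γ_{r₁}·W_{r₁+1}`. -/
theorem omega13_tridiagonal_on_Wvec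
    {V₁ V₂ V₃ : Type*} [AddCommGroup V₁] [Module ℂ V₁]
    [AddCommGroup V₂] [Module ℂ V₂] [AddCommGroup V₃] [Module ℂ V₃]
    (e₁ f₁ h₁ : Module.End ℂ V₁) (e₂ f₂ h₂ : Module.End ℂ V₂) (e₃ f₃ h₃ : Module.End ℂ V₃)
    (hsl1 : IsSl2Action e₁ f₁ h₁) (hsl2 : IsSl2Action e₂ f₂ h₂) (hsl3 : IsSl2Action e₃ f₃ h₃)
    (m₁ m₂ m₃ : ℕ) (v₁ : V₁) (v₂ : V₂) (v₃ : V₃)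
    (hv₁e : e₁ v₁ = 0) (hv₁h : h₁ v₁ = (m₁ : ℂ) • v₁) (hv₁nil : (f₁ ^ (m₁ + 1)) v₁ = 0)
    (hv₂e : e₂ v₂ = 0) (hv₂h : h₂ v₂ = (m₂ : ℂ) • v₂) (hv₂nil : (f₂ ^ (m₂ + 1)) v₂ = 0)
    (hv₃e : e₃ v₃ = 0) (hv₃h : h₃ v₃ = (m₃ : ℂ) • v₃) (hv₃nil : (f₃ ^ (m₃ + 1)) v₃ = 0)
    (r r₁ : ℕ) (hadm : Admissible m₁ m₂ m₃ r (r₁ : ℤ)) :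
    Omega13Triple (V₂ := V₂) e₁ f₁ h₁ e₃ f₃ h₃ (WvecZ f₁ f₂ f₃ v₁ v₂ v₃ m₁ m₂ m₃ r (r₁ : ℤ)) =
      (-(((r : ℂ) - (r₁ : ℂ) + 1) * ((m₃ : ℂ) - (r : ℂ) + (r₁ : ℂ)))) •
          WvecZ f₁ f₂ f₃ v₁ v₂ v₃ m₁ m₂ m₃ r ((r₁ : ℤ) - 1) +
        ((m₁ : ℂ) * ((m₃ : ℂ) - 2 * (r : ℂ)) / 2 +
            (r₁ : ℂ) * ((m₁ : ℂ) - (m₃ : ℂ) + 2 * (r : ℂ) - 2 * (r₁ : ℂ)) +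
            (r₁ : ℂ) * ((m₁ : ℂ) - (r₁ : ℂ) + 1) * ((r : ℂ) - (r₁ : ℂ) + 1) *
                ((m₃ : ℂ) - (r : ℂ) + (r₁ : ℂ)) /
              ((m₁ : ℂ) + (m₂ : ℂ) - 2 * (r₁ : ℂ) + 2) -
            ((r₁ : ℂ) + 1) * ((m₁ : ℂ) - (r₁ : ℂ)) * ((r : ℂ) - (r₁ : ℂ)) *
                ((m₃ : ℂ) - (r : ℂ) + (r₁ : ℂ) + 1) /
              ((m₁ : ℂ) + (m₂ : ℂ) - 2 * (r₁ : ℂ))) •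
          WvecZ f₁ f₂ f₃ v₁ v₂ v₃ m₁ m₂ m₃ r (r₁ : ℤ) +
        (-(((r₁ : ℂ) + 1) * ((m₁ : ℂ) - (r₁ : ℂ)) * ((m₂ : ℂ) - (r₁ : ℂ)) *
            ((m₁ : ℂ) + (m₂ : ℂ) - (r₁ : ℂ) + 1) *
            ((m₁ : ℂ) + (m₂ : ℂ) - (r : ℂ) - (r₁ : ℂ)) *
            ((m₁ : ℂ) + (m₂ : ℂ) + (m₃ : ℂ) - (r : ℂ) - (r₁ : ℂ) + 1) /
          (((m₁ : ℂ) + (m₂ : ℂ) - 2 * (r₁ : ℂ) - 1) *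
            ((m₁ : ℂ) + (m₂ : ℂ) - 2 * (r₁ : ℂ)) ^ 2 *
            ((m₁ : ℂ) + (m₂ : ℂ) - 2 * (r₁ : ℂ) + 1)))) •
          WvecZ f₁ f₂ f₃ v₁ v₂ v₃ m₁ m₂ m₃ r ((r₁ : ℤ) + 1) := by
  obtain ⟨hm₃, -, hkr, hk₁, hk₂, hks⟩ := id hadm
  obtain ⟨s, rfl⟩ := Nat.exists_eq_add_of_le (by omega : r₁ ≤ r)
  obtain ⟨M, hM⟩ := Nat.exists_eq_add_of_le' (by omega : 2 * r₁ ≤ m₁ + m₂)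
  have hk₁ : r₁ ≤ m₁ := by omega
  have hk₂ : r₁ ≤ m₂ := by omega
  have hsM : s ≤ M := by omega
  have hsm : s ≤ m₃ := by omega
  have hd₁ := hsl1.isLadder hv₁e hv₁h hv₁nil
  have hd₂ := hsl2.isLadder hv₂e hv₂h hv₂nil
  have hd₃ := hsl3.isLadder hv₃e hv₃h hv₃nil
  have hMc : (m₁ : ℂ) + m₂ - 2 * r₁ = M := by
    rw [sub_eq_iff_eq_add]; exact_mod_cast hM
  have hM1 : (M : ℂ) + 1 ≠ 0 := M.cast_add_one_ne_zero
  have hM2 : (M : ℂ) + 2 ≠ 0 := by exact_mod_cast (by omega : M + 2 ≠ 0)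
  set d₁ := ladder f₁ v₁ m₁ with hd₁_def
  set d₂ := ladder f₂ v₂ m₂ with hd₂_def
  set d₃ := ladder f₃ v₃ m₃ with hd₃_def
  set F := diagAct f₁ f₂ with hF
  set X := ladder F (singVec d₁ d₂ r₁) M with hX
  have hXl : IsLadder (diagAct e₁ e₂) F (diagAct h₁ h₂) M X :=
    isLadder_singVec hsl1 hsl2 hd₁ hd₂ hk₁ hk₂ hM
  set z := ladder F (shiftSeq (singVec d₁ d₂) r₁) (M + 2) with hz
  have hzF : ∀ n : ℕ, F (z n) = (((M : ℂ) - n + 2) * (n + 1)) • z (n + 1) := by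
    intro n
    rcases r₁ with _ | k
    · simp [hz, shiftSeq, ladder_of_zero]
    · rw [hz, shiftSeq, (isLadder_singVec hsl1 hsl2 hd₁ hd₂ (k := k) (M := M + 2)
        (by omega) (by omega) (by omega)).f_apply]
      congr 1; push_cast; ring
  obtain ⟨Y, hY₀, hY₁, hYF⟩ : ∃ Y : ℕ → V₁ ⊗[ℂ] V₂,
      (r₁ + 1 ≤ m₁ → r₁ + 1 ≤ m₂ → Y = ladder F (singVec d₁ d₂ (r₁ + 1)) (M - 2)) ∧
      (¬ (r₁ + 1 ≤ m₁ ∧ r₁ + 1 ≤ m₂) → Y = 0) ∧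
      (∀ n : ℕ, F (Y n) = (((M : ℂ) - n - 2) * (n + 1)) • Y (n + 1)) := by
    by_cases hcase : r₁ + 1 ≤ m₁ ∧ r₁ + 1 ≤ m₂
    · refine ⟨_, fun _ _ => rfl, fun h => absurd hcase h, fun n => ?_⟩
      rw [(isLadder_singVec hsl1 hsl2 hd₁ hd₂ (k := r₁ + 1) (M := M - 2)
        (by omega) (by omega) (by omega)).f_apply]
      congr 1
      rw [Nat.cast_sub (by omega)]; push_cast; ring
    · exact ⟨0, fun h h' => absurd ⟨h, h'⟩ hcase, fun _ => rfl, by simp⟩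
  set α : ℂ := -(((r₁ : ℂ) + 1) * (m₁ - r₁) * (m₂ - r₁) * (m₁ + m₂ - r₁ + 1)) / ((M + 1) * M) /
    (M * (M - 1)) with hα
  set p : ℂ := (m₁ : ℂ) - 2 * r₁ * (m₂ - r₁ + 1) / (M + 2) with hp
  have hα0 : ¬ (r₁ + 1 ≤ m₁ ∧ r₁ + 1 ≤ m₂) →
      ((r₁ : ℂ) + 1) * (m₁ - r₁) * (m₂ - r₁) * (m₁ + m₂ - r₁ + 1) = 0 := by
    intro h
    rcases (by omega : m₁ = r₁ ∨ m₂ = r₁) with h | h <;> rw [h] <;> simp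
  have hα0' : ¬ (r₁ + 1 ≤ m₁ ∧ r₁ + 1 ≤ m₂) → α = 0 := fun h => by
    rw [hα, hα0 h]; simp
  have hp0 : M = 0 → p = 0 := by
    rintro rfl
    obtain rfl : m₁ = r₁ := by omega
    obtain rfl : m₂ = m₁ := by omega
    simp [hp]
  have hpM : p / M * M = p := by
    rcases Nat.eq_zero_or_pos M with h | h
    · simp [hp0 h]
    · exact div_mul_cancel₀ _ (by exact_mod_cast h.ne')
  have hX0 : X 0 = singVec d₁ d₂ r₁ := ladder_zero _ _ _
  have hz0 : z 0 = shiftSeq (singVec d₁ d₂) r₁ := ladder_zero _ _ _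
  have hstr := string_action (x := shiftSeq X) (y := shiftSeq (shiftSeq Y)) (z := z) (M := M)
    (α := α) (β := p / M) (F := F) (e := LinearMap.rTensor V₂ e₁) (f := LinearMap.rTensor V₂ f₁)
    (h := LinearMap.rTensor V₂ h₁) rTensor_f_diagAct_f (rTensor_h_diagAct_f hsl1)
    (rTensor_e_diagAct_f hsl1) rfl
    (by
      rintro (_ | n)
      · simp [shiftSeq]
      · simp only [shiftSeq, hXl.f_apply]; congr 1; push_cast; ring)
    (by
      rintro (_ | _ | n)
      · simp [shiftSeq]
      · simp [shiftSeq]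
      · simp only [shiftSeq, hYF]; congr 1; push_cast; ring)
    hzF rfl rfl
    (by
      simp only [shiftSeq]
      rw [hX0, rTensor_f_singVec hd₁ hd₂ hk₁ hk₂ hM, ← hF, ← hX0, ← hz0, hXl.f_apply, hzF,
        map_smul, hzF]
      congr 1
      · congr 1
        · by_cases hcase : r₁ + 1 ≤ m₁ ∧ r₁ + 1 ≤ m₂
          · rw [hY₀ hcase.1 hcase.2, ladder_zero]
            congr 1
            have h2 : (M : ℂ) ≠ 0 := by exact_mod_cast (by omega : M ≠ 0)
            have h3 : (M : ℂ) - 1 ≠ 0 := sub_ne_zero.2 (by exact_mod_cast (by omega : M ≠ 1))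
            rw [hα, div_mul_cancel₀ _ (mul_ne_zero h2 h3)]
          · rw [hα0' hcase, hα0 hcase]; simp
        · rw [smul_smul]; congr 1; push_cast; ring
      · rw [smul_smul, smul_smul]; congr 1; push_cast; field_simp; ring)
    (by
      simp only [shiftSeq]
      rw [hX0, rTensor_h_singVec hd₁ hd₂ hM, ← hF, hpM, ← hz0, hzF, smul_smul]
      congr 2
      push_cast; field_simp; ring)
    (by
      simp only [shiftSeq]
      rw [hX0, rTensor_e_singVec hd₁ hk₁, hz0])
  have main := casimir_altSum (m := m₃) (s := s) hd₃ hsm rfl rfl rfl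
    fun n hn => hstr n (hn.trans hsM)
  have hW : WvecZ f₁ f₂ f₃ v₁ v₂ v₃ m₁ m₂ m₃ (r₁ + s) (r₁ : ℤ) = altSum X d₃ s fun _ _ => 1 := by
    rw [WvecZ, if_pos hadm, Int.toNat_natCast, Wvec_eq_altSum _ _ _ _ _ _ _ _ hM,
      Nat.add_sub_cancel_left]
  have hxs : altSum (shiftSeq X) (shiftSeq d₃) (s + 2) (fun _ _ => 1) =
      -altSum X d₃ s fun _ _ => 1 := by
    rw [altSum_shift, altSum_shift_right]
  have hys : altSum (shiftSeq (shiftSeq Y)) (shiftSeq d₃) (s + 2) (fun _ _ => 1) =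
      altSum Y (shiftSeq d₃) s fun _ _ => 1 := by
    rw [altSum_shift, altSum_shift, neg_neg]
  rw [hxs, hys, altSum_shift_right] at main
  rw [hW, show ∀ w, Omega13Triple (V₂ := V₂) e₁ f₁ h₁ e₃ f₃ h₃ w = _ from fun _ => rfl]
  refine main.trans ?_
  rw [add_comm, ← add_assoc, add_right_comm]
  congr 1
  · congr 1
    · rw [WvecZ]
      split_ifs with hk
      · obtain ⟨k, rfl⟩ : ∃ k, r₁ = k + 1 := ⟨r₁ - 1, by have := hk.2.1; omega⟩
        rw [show ((k + 1 : ℕ) : ℤ) - 1 = (k : ℕ) by push_cast; ring, Int.toNat_natCast,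
          Wvec_eq_altSum _ _ _ _ _ _ (M := M + 2) _ _ (by omega),
          show k + 1 + s - k = s + 1 by omega]
        congr 1
        push_cast; ring
      · rw [smul_zero]
        rcases Nat.eq_zero_or_pos r₁ with rfl | hpos
        · rw [hz, shiftSeq, ladder_of_zero, altSum_zero_left, smul_zero]
        · have : s = m₃ := by
            by_contra hne
            refine hk ⟨?_, ?_, ?_, ?_, ?_, ?_⟩ <;> push_cast <;> omega
          rw [this, sub_self, mul_zero, zero_smul]
    · rw [smul_neg, ← neg_smul]
      congr 1
      rw [hMc, hp]
      push_cast
      rcases Nat.eq_zero_or_pos M with h | h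
      · obtain rfl : s = 0 := by omega
        obtain rfl : m₁ = r₁ := by omega
        obtain rfl : m₂ = m₁ := by omega
        subst h
        simp
        ring
      · have h0 : (M : ℂ) ≠ 0 := by exact_mod_cast h.ne'
        obtain hm₁ : (m₁ : ℂ) = M + 2 * r₁ - m₂ := by rw [← hMc]; ring
        rw [hm₁]
        field_simp
        ring
  · rw [WvecZ]
    split_ifs with hk
    · obtain ⟨t, rfl⟩ : ∃ t, s = t + 1 := ⟨s - 1, by have := hk.2.2.1; push_cast at this; omega⟩
      obtain ⟨-, -, -, hk1, hk2, -⟩ := hk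
      have hk1 : r₁ + 1 ≤ m₁ := by omega
      have hk2 : r₁ + 1 ≤ m₂ := by omega
      rw [show (r₁ : ℤ) + 1 = (r₁ + 1 : ℕ) by push_cast; ring, Int.toNat_natCast,
        Wvec_eq_altSum _ _ _ _ _ _ (M := M - 2) _ _ (by omega),
        show r₁ + (t + 1) - (r₁ + 1) = t by omega, altSum_shift_right, hY₀ hk1 hk2]
      congr 1
      have h2 : (M : ℂ) ≠ 0 := by exact_mod_cast (by omega : M ≠ 0)
      have h3 : (M : ℂ) - 1 ≠ 0 := sub_ne_zero.2 (by exact_mod_cast (by omega : M ≠ 1))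
      have hm₁ : (m₁ : ℂ) = M + 2 * r₁ - m₂ := by rw [← hMc]; ring
      rw [hMc, hα, hm₁]
      push_cast
      field_simp
      ring
    · rw [smul_zero]
      by_cases hcase : r₁ + 1 ≤ m₁ ∧ r₁ + 1 ≤ m₂
      · rcases Nat.eq_zero_or_pos s with rfl | hpos
        · simp [altSum, shiftSeq]
        · have : s = M := by
            by_contra hne
            refine hk ⟨?_, ?_, ?_, ?_, ?_, ?_⟩ <;> push_cast <;> omega
          rw [this, sub_self, zero_mul, mul_zero, zero_smul]
      · rw [hα0' hcase, zero_mul, zero_smul]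
end

section
/- Let M be a symmetric n×n complex matrix with det(M) = 0, and let v := adj(M)·e_n, where e_n is the last standard basis vector. Then vᵀ·v = trace(adj(M)) · (e_nᵀ·v), i.e. Σ_{k=1}^{n} v_k² = trace(adj(M)) · v_n. -/
namespace Matrix

variable {ι K : Type*} [Fintype ι] [DecidableEq ι] [CommRing K] [IsDomain K]

/-- If an entry `(i, j)` of the adjugate is nonzero, then a kernel vector is determined by its
`i`-th coordinate. -/
theorem eq_zero_of_mulVec_eq_zero_of_adjugate_apply_ne_zero {M : Matrix ι ι K} {i j : ι}
    (hij : M.adjugate i j ≠ 0) {z : ι → K} (hz : M *ᵥ z = 0) (hzi : z i = 0) : z = 0 := by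
  rw [adjugate_apply] at hij
  refine eq_zero_of_mulVec_eq_zero hij ?_
  ext k
  rcases eq_or_ne k j with rfl | hk
  · simp [mulVec, hzi]
  · simpa [mulVec, hk] using congrFun hz k

theorem adjugate_apply_mul_adjugate_apply_of_ne_zero {M : Matrix ι ι K} (hM : M.det = 0)
    {i j : ι} (hij : M.adjugate i j ≠ 0) (k l : ι) :
    M.adjugate i j * M.adjugate k l = M.adjugate i l * M.adjugate k j := by
  have hcol (l : ι) : M *ᵥ M.adjugate.col l = 0 := by
    ext k
    simpa [hM, mul_apply, mulVec, dotProduct] using congrFun (congrFun M.mul_adjugate k) l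
  have h := eq_zero_of_mulVec_eq_zero_of_adjugate_apply_ne_zero hij
    (z := M.adjugate i j • M.adjugate.col l - M.adjugate i l • M.adjugate.col j)
    (by simp [mulVec_sub, mulVec_smul, hcol]) (by simp [mul_comm])
  simpa [sub_eq_zero] using congrFun h k

/-- The `2 × 2` minors of the adjugate of a singular matrix vanish. -/
theorem adjugate_apply_mul_adjugate_apply {M : Matrix ι ι K} (hM : M.det = 0) (i j k l : ι) :
    M.adjugate i j * M.adjugate k l = M.adjugate i l * M.adjugate k j := by
  by_cases hij : M.adjugate i j = 0
  · by_cases hil : M.adjugate i l = 0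
    · simp [hij, hil]
    · exact (adjugate_apply_mul_adjugate_apply_of_ne_zero hM hil k j).symm
  · exact adjugate_apply_mul_adjugate_apply_of_ne_zero hM hij k l

end Matrix

/-- For a symmetric matrix `M` with `det M = 0` and `v = adj(M)·e_n`, one has
`vᵀ·v = trace(adj M) · v_n`. -/
theorem adjugate_vector_isotropy (n : ℕ) (hn : 1 ≤ n)
    (M : Matrix (Fin n) (Fin n) ℂ) (hsym : M.IsSymm) (hdet : M.det = 0) :
    ∑ k : Fin n, (M.adjugate.mulVec (Pi.single (⟨n - 1, by omega⟩ : Fin n) (1 : ℂ)) k) ^ 2 =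
      M.adjugate.trace *
        M.adjugate.mulVec (Pi.single (⟨n - 1, by omega⟩ : Fin n) (1 : ℂ))
          ⟨n - 1, by omega⟩ := by
  generalize (⟨n - 1, by omega⟩ : Fin n) = m
  simp only [Matrix.mulVec_single_one, Matrix.col_apply, Matrix.trace, Matrix.diag_apply,
    Finset.sum_mul]
  refine Finset.sum_congr rfl fun k _ => ?_
  rw [Matrix.adjugate_apply_mul_adjugate_apply hdet k k m m, hsym.adjugate.apply k m, sq]
end
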